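/- arXiv:2305.13362 — 4 statements merged into one kernel-verified Lean document; each statement's English description precedes it below -/
import Mathlib

section
/- Let E be a complex d×d matrix with 0 ≤ E ≤ I (E Hermitian positive semidefinite with I − E positive semidefinite), d ≥ 2, and let η ≥ 0. Suppose that for every pair of orthogonal unit vectors ψ, φ ∈ ℂ^d one has ⟨ψ, Eψ⟩ ≤ e^η ⟨φ, Eφ⟩. Then for every pair of unit vectors ψ, φ ∈ ℂ^d (not necessarily orthogonal), ⟨ψ, Eψ⟩ ≤ e^η ⟨φ, Eφ⟩. -/
open Matrix
open scoped ComplexOrder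

/-- A unitary matrix preserves the standard inner product. -/
theorem star_mulVec_dotProduct_mulVec_of_unitary {n : Type*} [Fintype n] [DecidableEq n]
    (U : unitaryGroup n ℂ) (x y : n → ℂ) :
    star ((U : Matrix n n ℂ) *ᵥ x) ⬝ᵥ ((U : Matrix n n ℂ) *ᵥ y) = star x ⬝ᵥ y := by
  rw [star_mulVec, ← dotProduct_mulVec, mulVec_mulVec, ← star_eq_conjTranspose,
    Unitary.coe_star_mul_self, one_mulVec]

/-- In eigenvector coordinates, the quadratic form of a Hermitian matrix is diagonal. -/
theorem Matrix.IsHermitian.re_star_dotProduct_mulVec_eigenvectorUnitary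
    {n : Type*} [Fintype n] [DecidableEq n] {E : Matrix n n ℂ} (hE : E.IsHermitian) (x : n → ℂ) :
    (star ((hE.eigenvectorUnitary : Matrix n n ℂ) *ᵥ x) ⬝ᵥ
      (E *ᵥ ((hE.eigenvectorUnitary : Matrix n n ℂ) *ᵥ x))).re =
      ∑ i, hE.eigenvalues i * Complex.normSq (x i) := by
  have hEU : E * (hE.eigenvectorUnitary : Matrix n n ℂ) =
      (hE.eigenvectorUnitary : Matrix n n ℂ) *
        diagonal (fun i => (hE.eigenvalues i : ℂ)) := by
    conv_lhs => enter [1]; rw [hE.spectral_theorem]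
    rw [Unitary.conjStarAlgAut_apply, Matrix.mul_assoc, Unitary.coe_star_mul_self, Matrix.mul_one]
    rfl
  rw [mulVec_mulVec, hEU, ← mulVec_mulVec, star_mulVec_dotProduct_mulVec_of_unitary]
  simp only [dotProduct, mulVec_diagonal, Complex.re_sum, Pi.star_apply]
  refine Finset.sum_congr rfl fun i _ => ?_
  simp [Complex.normSq_apply]
  ring

theorem sum_normSq_eq_one_of_star_dotProduct_self {n : Type*} [Fintype n] {x : n → ℂ}
    (hx : star x ⬝ᵥ x = 1) : ∑ i, Complex.normSq (x i) = 1 := by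
  have := congrArg Complex.re hx
  simpa [dotProduct, Complex.normSq_apply] using this

/-- Trivial-measurement lemma: if a POVM element `0 ≤ E ≤ I` on `ℂ^d`
(`d ≥ 2`) satisfies `⟨ψ, Eψ⟩ ≤ e^η ⟨φ, Eφ⟩` for every pair of *orthogonal* unit vectors,
then the same inequality holds for every pair of unit vectors. -/
theorem statement6 {d : ℕ} (hd : 2 ≤ d)
    (E : Matrix (Fin d) (Fin d) ℂ) (hE : E.PosSemidef) (hE' : (1 - E).PosSemidef)
    (η : ℝ) (hη : 0 ≤ η)
    (h : ∀ ψ φ : Fin d → ℂ, star ψ ⬝ᵥ ψ = 1 → star φ ⬝ᵥ φ = 1 → star ψ ⬝ᵥ φ = 0 →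
      (star ψ ⬝ᵥ (E *ᵥ ψ)).re ≤ Real.exp η * (star φ ⬝ᵥ (E *ᵥ φ)).re) :
    ∀ ψ φ : Fin d → ℂ, star ψ ⬝ᵥ ψ = 1 → star φ ⬝ᵥ φ = 1 →
      (star ψ ⬝ᵥ (E *ᵥ ψ)).re ≤ Real.exp η * (star φ ⬝ᵥ (E *ᵥ φ)).re := by
  have hH := hE.isHermitian
  set U := hH.eigenvectorUnitary with hU
  have hone : 1 ≤ Real.exp η := Real.one_le_exp hη
  have hev : ∀ i j, hH.eigenvalues i ≤ Real.exp η * hH.eigenvalues j := by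
    intro i j
    rcases eq_or_ne i j with rfl | hij
    · exact le_mul_of_one_le_left (hE.eigenvalues_nonneg i) hone
    · have key := h ((U : Matrix (Fin d) (Fin d) ℂ) *ᵥ Pi.single i 1)
        ((U : Matrix (Fin d) (Fin d) ℂ) *ᵥ Pi.single j 1)
        (by rw [star_mulVec_dotProduct_mulVec_of_unitary]; simp)
        (by rw [star_mulVec_dotProduct_mulVec_of_unitary]; simp)
        (by rw [star_mulVec_dotProduct_mulVec_of_unitary]; simp [hij])
      rw [hU, hH.re_star_dotProduct_mulVec_eigenvectorUnitary,
        hH.re_star_dotProduct_mulVec_eigenvectorUnitary] at key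
      simpa [Pi.single_apply, apply_ite Complex.normSq] using key
  intro ψ φ hψ hφ
  have hsurj : ∀ v : Fin d → ℂ, ∃ x, (U : Matrix (Fin d) (Fin d) ℂ) *ᵥ x = v := fun v =>
    ⟨star (U : Matrix (Fin d) (Fin d) ℂ) *ᵥ v, by
      rw [mulVec_mulVec, Unitary.mul_star_self_of_mem U.2, one_mulVec]⟩
  obtain ⟨x, rfl⟩ := hsurj ψ
  obtain ⟨y, rfl⟩ := hsurj φ
  rw [star_mulVec_dotProduct_mulVec_of_unitary] at hψ hφ
  have hx := sum_normSq_eq_one_of_star_dotProduct_self hψ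
  have hy := sum_normSq_eq_one_of_star_dotProduct_self hφ
  rw [hU, hH.re_star_dotProduct_mulVec_eigenvectorUnitary,
    hH.re_star_dotProduct_mulVec_eigenvectorUnitary]
  have hbound : ∀ j, ∑ i, hH.eigenvalues i * Complex.normSq (x i) ≤
      Real.exp η * hH.eigenvalues j := fun j => by
    calc ∑ i, hH.eigenvalues i * Complex.normSq (x i)
        ≤ ∑ i, Real.exp η * hH.eigenvalues j * Complex.normSq (x i) :=
          Finset.sum_le_sum fun i _ =>
            mul_le_mul_of_nonneg_right (hev i j) (Complex.normSq_nonneg _)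
      _ = Real.exp η * hH.eigenvalues j := by rw [← Finset.mul_sum, hx, mul_one]
  calc ∑ i, hH.eigenvalues i * Complex.normSq (x i)
      = ∑ j, (∑ i, hH.eigenvalues i * Complex.normSq (x i)) * Complex.normSq (y j) := by
        rw [← Finset.mul_sum, hy, mul_one]
    _ ≤ ∑ j, Real.exp η * hH.eigenvalues j * Complex.normSq (y j) :=
        Finset.sum_le_sum fun j _ =>
          mul_le_mul_of_nonneg_right (hbound j) (Complex.normSq_nonneg _)
    _ = Real.exp η * ∑ j, hH.eigenvalues j * Complex.normSq (y j) := by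
        simp only [Finset.mul_sum, mul_assoc]
end

section
/- Fix d ≥ 2 and α with 0 ≤ α ≤ 1/4.01. Let A, B be complex d×d matrices with A*A + B*B = I, defining a two-outcome measurement whose outcome probabilities on a density matrix ρ are Tr(A*Aρ) and Tr(B*Bρ), with post-selected states AρA*/Tr(A*Aρ) and BρB*/Tr(B*Bρ) respectively (whenever the corresponding probability is nonzero). Suppose the measurement is α-gentle on all states: for every density matrix ρ and each outcome of nonzero probability, the trace distance between the post-selected state and ρ is at most α. Then the measurement is O(α)-trivial; precisely, for every pair of orthogonal unit vectors ψ, φ ∈ ℂ^d, ⟨ψ, A*Aψ⟩ ≤ ((1 + 4α)/(1 − 4α)) · ⟨φ, A*Aφ⟩, and likewise with A replaced by B. -/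
open Matrix
open scoped ComplexOrder

/-- The trace norm (sum of singular values) of a complex square matrix. -/
noncomputable def traceNorm {d : ℕ} (A : Matrix (Fin d) (Fin d) ℂ) : ℝ :=
  ∑ i, Real.sqrt ((Matrix.posSemidef_conjTranspose_mul_self A).1.eigenvalues i)

/-- `A` is a density matrix: positive semidefinite with trace 1. -/
def IsDensityMatrix {d : ℕ} (A : Matrix (Fin d) (Fin d) ℂ) : Prop :=
  A.PosSemidef ∧ A.trace = 1

/-- The post-selected state `AρA*/Tr(A*Aρ)`. -/
noncomputable def postState {d : ℕ} (A ρ : Matrix (Fin d) (Fin d) ℂ) :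
    Matrix (Fin d) (Fin d) ℂ :=
  ((Aᴴ * A * ρ).trace)⁻¹ • (A * ρ * Aᴴ)

theorem norm_toLp_eq_one {d : ℕ} {ψ : Fin d → ℂ} (hψ : star ψ ⬝ᵥ ψ = 1) :
    ‖WithLp.toLp 2 ψ‖ = 1 := by
  rw [norm_eq_sqrt_re_inner (𝕜 := ℂ), EuclideanSpace.inner_toLp_toLp, dotProduct_comm, hψ]
  simp

/-- For orthonormal `ψ, φ`, testing a matrix against `ψψ* - φφ*` gives at most its trace norm. -/
theorem norm_quadForm_sub_quadForm_le_traceNorm {d : ℕ} (K : Matrix (Fin d) (Fin d) ℂ)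
    {ψ φ : Fin d → ℂ} (hψ : star ψ ⬝ᵥ ψ = 1) (hφ : star φ ⬝ᵥ φ = 1) (hψφ : star ψ ⬝ᵥ φ = 0) :
    ‖star ψ ⬝ᵥ (K *ᵥ ψ) - star φ ⬝ᵥ (K *ᵥ φ)‖ ≤ traceNorm K := by
  have hM := (Matrix.posSemidef_conjTranspose_mul_self K).1
  set b := hM.eigenvectorBasis
  have inner_toLp : ∀ x y : Fin d → ℂ,
      inner ℂ (WithLp.toLp 2 x) (WithLp.toLp 2 y) = star x ⬝ᵥ y := fun x y => by
    rw [EuclideanSpace.inner_toLp_toLp, dotProduct_comm]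
  have bessel : ∀ x : EuclideanSpace ℂ (Fin d),
      ‖inner ℂ (WithLp.toLp 2 ψ) x‖ ^ 2 + ‖inner ℂ (WithLp.toLp 2 φ) x‖ ^ 2 ≤ ‖x‖ ^ 2 := by
    intro x
    have hon : Orthonormal ℂ ![WithLp.toLp 2 ψ, WithLp.toLp 2 φ] := by
      rw [orthonormal_iff_ite]
      have hφψ : star φ ⬝ᵥ ψ = 0 := by rw [star_dotProduct, hψφ, star_zero]
      intro i j
      fin_cases i <;> fin_cases j <;>
        simp [inner_toLp, norm_toLp_eq_one hψ, norm_toLp_eq_one hφ, hψφ, hφψ]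
    simpa using hon.sum_inner_products_le x (s := Finset.univ)
  have expand : ∀ x : Fin d → ℂ, star x ⬝ᵥ (K *ᵥ x) =
      ∑ i, inner ℂ (WithLp.toLp 2 x) (WithLp.toLp 2 (K *ᵥ (b i).ofLp)) *
        inner ℂ (b i) (WithLp.toLp 2 x) := by
    intro x
    have h := b.sum_inner_mul_inner (WithLp.toLp 2 (Kᴴ *ᵥ x)) (WithLp.toLp 2 x)
    rw [inner_toLp, star_mulVec, conjTranspose_conjTranspose, ← dotProduct_mulVec] at h
    rw [← h]
    refine Finset.sum_congr rfl fun i _ => ?_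
    congr 1
    rw [inner_toLp, star_mulVec, conjTranspose_conjTranspose, ← dotProduct_mulVec, inner_toLp]
  have norm_image : ∀ i, ‖WithLp.toLp 2 (K *ᵥ (b i).ofLp)‖ = Real.sqrt (hM.eigenvalues i) := by
    intro i
    rw [norm_eq_sqrt_re_inner (𝕜 := ℂ), inner_toLp, star_mulVec, ← dotProduct_mulVec,
      mulVec_mulVec, hM.mulVec_eigenvectorBasis, dotProduct_smul, ← inner_toLp]
    simp [b]
  rw [expand ψ, expand φ, ← Finset.sum_sub_distrib]
  refine (norm_sum_le _ _).trans (Finset.sum_le_sum fun i _ => ?_)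
  change _ ≤ Real.sqrt (hM.eigenvalues i)
  rw [← norm_image i]
  refine (norm_sub_le _ _).trans ?_
  rw [norm_mul, norm_mul, norm_inner_symm (b i), norm_inner_symm (b i)]
  have h1 := bessel (WithLp.toLp 2 (K *ᵥ (b i).ofLp))
  have h2 := bessel (b i)
  rw [b.norm_eq_one i] at h2
  set s := ‖inner ℂ (WithLp.toLp 2 ψ) (WithLp.toLp 2 (K *ᵥ (b i).ofLp))‖
  set t := ‖inner ℂ (WithLp.toLp 2 φ) (WithLp.toLp 2 (K *ᵥ (b i).ofLp))‖
  set s' := ‖inner ℂ (WithLp.toLp 2 ψ) (b i)‖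
  set t' := ‖inner ℂ (WithLp.toLp 2 φ) (b i)‖
  set n := ‖WithLp.toLp 2 (K *ᵥ (b i).ofLp)‖
  refine abs_le_of_sq_le_sq' ?_ (norm_nonneg _) |>.2
  nlinarith [sq_nonneg (s * t' - t * s'), mul_le_mul h1 h2 (by positivity) (by positivity)]

theorem isDensityMatrix_vecMulVec {d : ℕ} {v : Fin d → ℂ} (hv : star v ⬝ᵥ v = 1) :
    IsDensityMatrix (vecMulVec v (star v)) :=
  ⟨posSemidef_vecMulVec_self_star v, by rw [trace_vecMulVec, dotProduct_comm, hv]⟩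

theorem isDensityMatrix_midpoint {d : ℕ} {ρ σ : Matrix (Fin d) (Fin d) ℂ}
    (hρ : IsDensityMatrix ρ) (hσ : IsDensityMatrix σ) :
    IsDensityMatrix ((2⁻¹ : ℂ) • (ρ + σ)) := by
  refine ⟨(hρ.1.add hσ.1).smul (by positivity), ?_⟩
  rw [trace_smul, trace_add, hρ.2, hσ.2, smul_eq_mul]
  norm_num

theorem quadForm_conj_vecMulVec {d : ℕ} (A : Matrix (Fin d) (Fin d) ℂ) (v ψ : Fin d → ℂ) :
    star ψ ⬝ᵥ ((A * vecMulVec v (star v) * Aᴴ) *ᵥ ψ) =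
      ((‖star ψ ⬝ᵥ (A *ᵥ v)‖ ^ 2 : ℝ) : ℂ) := by
  rw [mul_vecMulVec, vecMulVec_mul, ← star_mulVec, vecMulVec_mulVec, dotProduct_smul,
    Complex.ofReal_pow, ← Complex.mul_conj', starRingEnd_apply, ← star_dotProduct]
  rfl

theorem trace_mul_vecMulVec_star {d : ℕ} (M : Matrix (Fin d) (Fin d) ℂ) (v : Fin d → ℂ) :
    (M * vecMulVec v (star v)).trace = star v ⬝ᵥ (M *ᵥ v) := by
  rw [mul_vecMulVec, trace_vecMulVec, dotProduct_comm]

theorem quadForm_gram {d : ℕ} (A : Matrix (Fin d) (Fin d) ℂ) (v : Fin d → ℂ) :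
    star v ⬝ᵥ ((Aᴴ * A) *ᵥ v) = ((‖WithLp.toLp 2 (A *ᵥ v)‖ ^ 2 : ℝ) : ℂ) := by
  rw [← mulVec_mulVec, dotProduct_mulVec, ← star_mulVec, dotProduct_comm,
    ← EuclideanSpace.inner_toLp_toLp, inner_self_eq_norm_sq_to_K]
  simp

theorem norm_dotProduct_le_of_unit {d : ℕ} {ψ : Fin d → ℂ} (hψ : star ψ ⬝ᵥ ψ = 1)
    (x : Fin d → ℂ) : ‖star ψ ⬝ᵥ x‖ ≤ ‖WithLp.toLp 2 x‖ := by
  have h := norm_inner_le_norm (𝕜 := ℂ) (WithLp.toLp 2 ψ) (WithLp.toLp 2 x)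
  rwa [norm_toLp_eq_one hψ, one_mul, EuclideanSpace.inner_toLp_toLp, dotProduct_comm] at h

/-- One outcome operator that is `α`-gentle on all states has nearly equal expectations on
orthogonal pure states. -/
theorem quadForm_le_of_gentle {d : ℕ} {α : ℝ} (hα0 : 0 ≤ α) (hα1 : α < 1 / 4)
    {A : Matrix (Fin d) (Fin d) ℂ}
    (hgentle : ∀ ρ : Matrix (Fin d) (Fin d) ℂ, IsDensityMatrix ρ →
      (Aᴴ * A * ρ).trace ≠ 0 → (1 / 2) * traceNorm (postState A ρ - ρ) ≤ α)
    {ψ φ : Fin d → ℂ} (hψ : star ψ ⬝ᵥ ψ = 1) (hφ : star φ ⬝ᵥ φ = 1) (hψφ : star ψ ⬝ᵥ φ = 0) :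
    (star ψ ⬝ᵥ ((Aᴴ * A) *ᵥ ψ)).re ≤
      ((1 + 4 * α) / (1 - 4 * α)) * (star φ ⬝ᵥ ((Aᴴ * A) *ᵥ φ)).re := by
  have hφψ : star φ ⬝ᵥ ψ = 0 := by rw [star_dotProduct, hψφ, star_zero]
  have hQψ := quadForm_gram A ψ
  have hQφ := quadForm_gram A φ
  have hle := norm_dotProduct_le_of_unit hφ (A *ᵥ φ)
  rw [hQψ, hQφ, Complex.ofReal_re, Complex.ofReal_re]
  have hle2 := pow_le_pow_left₀ (norm_nonneg _) hle 2
  have test : ∀ ρ : Matrix (Fin d) (Fin d) ℂ, IsDensityMatrix ρ → ∀ t f g : ℝ, 0 < t →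
      (Aᴴ * A * ρ).trace = t →
      star ψ ⬝ᵥ ((A * ρ * Aᴴ) *ᵥ ψ) - star φ ⬝ᵥ ((A * ρ * Aᴴ) *ᵥ φ) = f →
      star ψ ⬝ᵥ (ρ *ᵥ ψ) - star φ ⬝ᵥ (ρ *ᵥ φ) = g →
      |f - t * g| ≤ 2 * α * t := by
    intro ρ hρ t f g ht htr hf hg
    have h1 := hgentle ρ hρ (by rw [htr]; exact_mod_cast ht.ne')
    have h2 := norm_quadForm_sub_quadForm_le_traceNorm (postState A ρ - ρ) hψ hφ hψφ
    have h3 : star ψ ⬝ᵥ ((postState A ρ - ρ) *ᵥ ψ) - star φ ⬝ᵥ ((postState A ρ - ρ) *ᵥ φ)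
        = ((t⁻¹ * f - g : ℝ) : ℂ) := by
      rw [Complex.ofReal_sub, Complex.ofReal_mul, ← hf, ← hg, postState, htr]
      simp only [sub_mulVec, smul_mulVec, dotProduct_sub, dotProduct_smul, smul_eq_mul]
      push_cast
      ring
    rw [h3, Complex.norm_real, Real.norm_eq_abs] at h2
    have h4 : f - t * g = t * (t⁻¹ * f - g) := by field_simp
    rw [h4, abs_mul, abs_of_pos ht]
    nlinarith
  set p := ‖WithLp.toLp 2 (A *ᵥ ψ)‖ ^ 2
  set q := ‖WithLp.toLp 2 (A *ᵥ φ)‖ ^ 2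
  have hq0 : 0 ≤ q := by positivity
  rw [div_mul_eq_mul_div, le_div_iff₀ (by linarith)]
  rcases (show 0 ≤ p by positivity).eq_or_lt with hp | hp
  · rw [← hp, zero_mul]
    positivity
  set a := ‖star ψ ⬝ᵥ (A *ᵥ ψ)‖ ^ 2 with ha
  set b := ‖star φ ⬝ᵥ (A *ᵥ ψ)‖ ^ 2 with hb
  set c := ‖star ψ ⬝ᵥ (A *ᵥ φ)‖ ^ 2 with hc
  set e := ‖star φ ⬝ᵥ (A *ᵥ φ)‖ ^ 2 with he
  have hc0 : 0 ≤ c := by positivity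
  have hpure := test _ (isDensityMatrix_vecMulVec hψ) p (a - b) 1 hp
    (by rw [trace_mul_vecMulVec_star, hQψ])
    (by rw [quadForm_conj_vecMulVec, quadForm_conj_vecMulVec, Complex.ofReal_sub])
    (by simp [vecMulVec_mulVec, hψ, hψφ])
  have hmixed := test _ (isDensityMatrix_midpoint (isDensityMatrix_vecMulVec hψ)
    (isDensityMatrix_vecMulVec hφ)) ((p + q) / 2) ((a - b + c - e) / 2) 0 (by positivity)
    (by
      rw [Matrix.mul_smul, trace_smul, mul_add, trace_add, trace_mul_vecMulVec_star,
        trace_mul_vecMulVec_star, hQψ, hQφ, smul_eq_mul]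
      push_cast
      ring)
    (by
      simp only [Matrix.mul_smul, Matrix.smul_mul, mul_add, add_mul, smul_mulVec,
        add_mulVec, dotProduct_smul, dotProduct_add, quadForm_conj_vecMulVec, smul_eq_mul, ← ha, ← hb, ← hc, ← he]
      push_cast
      ring)
    (by simp [smul_mulVec, add_mulVec, vecMulVec_mulVec, hψ, hφ, hψφ, hφψ])
  have h1 := (abs_le.1 hpure).1
  have h2 := (abs_le.1 hmixed).2
  nlinarith

/-- Triviality lemma: a two-outcome measurement `{A, B}`
(`A*A + B*B = I`) that is `α`-gentle on all density matrices (`0 ≤ α ≤ 1/4.01`) is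
`O(α)`-trivial: for all orthogonal unit vectors `ψ, φ`,
`⟨ψ, A*Aψ⟩ ≤ ((1+4α)/(1−4α))⟨φ, A*Aφ⟩`, and likewise for `B`. -/
theorem statement7 {d : ℕ} (hd : 2 ≤ d) (α : ℝ) (hα0 : 0 ≤ α) (hα1 : α ≤ 1 / 4.01)
    (A B : Matrix (Fin d) (Fin d) ℂ) (hAB : Aᴴ * A + Bᴴ * B = 1)
    (hgentleA : ∀ ρ : Matrix (Fin d) (Fin d) ℂ, IsDensityMatrix ρ →
      (Aᴴ * A * ρ).trace ≠ 0 → (1 / 2) * traceNorm (postState A ρ - ρ) ≤ α)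
    (hgentleB : ∀ ρ : Matrix (Fin d) (Fin d) ℂ, IsDensityMatrix ρ →
      (Bᴴ * B * ρ).trace ≠ 0 → (1 / 2) * traceNorm (postState B ρ - ρ) ≤ α) :
    ∀ ψ φ : Fin d → ℂ, star ψ ⬝ᵥ ψ = 1 → star φ ⬝ᵥ φ = 1 → star ψ ⬝ᵥ φ = 0 →
      (star ψ ⬝ᵥ ((Aᴴ * A) *ᵥ ψ)).re ≤
        ((1 + 4 * α) / (1 - 4 * α)) * (star φ ⬝ᵥ ((Aᴴ * A) *ᵥ φ)).re ∧
      (star ψ ⬝ᵥ ((Bᴴ * B) *ᵥ ψ)).re ≤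
        ((1 + 4 * α) / (1 - 4 * α)) * (star φ ⬝ᵥ ((Bᴴ * B) *ᵥ φ)).re := by
  intro ψ φ hψ hφ hψφ
  have hα : α < 1 / 4 := hα1.trans_lt (by norm_num)
  exact ⟨quadForm_le_of_gentle hα0 hα hgentleA hψ hφ hψφ,
    quadForm_le_of_gentle hα0 hα hgentleB hψ hφ hψφ⟩
end

section
/- Let M ≥ 2, let {a_k}_{k=1}^M be an orthonormal family in a finite-dimensional complex inner product space K, and let ψ_1, …, ψ_M, φ_1, …, φ_M be unit vectors in a finite-dimensional complex inner product space H such that ψ_k = φ_k for all k ≠ m and ⟨ψ_m, φ_m⟩ = 0 for some index m. Define the unit vectors Ψ = (1/√M)·Σ_{k=1}^M a_k ⊗ ψ_k and Φ = (1/√M)·Σ_{k=1}^M a_k ⊗ φ_k in K ⊗ H. Then: (i) ⟨Ψ, Φ⟩ = 1 − 1/M; and (ii) for every natural number N, if (1 − 1/M)^{2N} ≤ 0.36 then N ≥ (M − 1)·ln(25/9)/2, so that N = Ω(M). -/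
open Matrix

/-- The inner product of elementary tensors, in coordinates. -/
lemma star_dotProduct_tensor {ι κ : Type*} [Fintype ι] [Fintype κ]
    (a b : ι → ℂ) (x y : κ → ℂ) :
    star (fun r : ι × κ => a r.1 * x r.2) ⬝ᵥ (fun r : ι × κ => b r.1 * y r.2)
      = (star a ⬝ᵥ b) * (star x ⬝ᵥ y) := by
  simp only [dotProduct, Fintype.sum_prod_type, Finset.sum_mul_sum, Pi.star_apply, star_mul']
  exact Finset.sum_congr rfl fun _ _ => Finset.sum_congr rfl fun _ _ => by ring

/-- The inner product of two superpositions of tensors along the same orthonormal family. -/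
lemma star_dotProduct_sum_tensor {n ι κ : Type*} [Fintype n] [DecidableEq n]
    [Fintype ι] [Fintype κ] (a : n → ι → ℂ)
    (ha : ∀ k l, star (a k) ⬝ᵥ a l = if k = l then 1 else 0)
    (x y : n → κ → ℂ) (c d : ℂ) :
    star (fun r : ι × κ => c * ∑ k, a k r.1 * x k r.2) ⬝ᵥ
        (fun r : ι × κ => d * ∑ k, a k r.1 * y k r.2)
      = star c * d * ∑ k, star (x k) ⬝ᵥ y k := by
  have superposition (e : ℂ) (z : n → κ → ℂ) :
      (fun r : ι × κ => e * ∑ k, a k r.1 * z k r.2)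
        = e • ∑ k, fun r : ι × κ => a k r.1 * z k r.2 := by
    ext r
    simp
  simp only [superposition, star_smul, star_sum, smul_dotProduct, dotProduct_smul,
    sum_dotProduct, dotProduct_sum, star_dotProduct_tensor, ha, smul_eq_mul]
  simp [← Finset.mul_sum, mul_left_comm, mul_assoc]

/-- If `(1 - 1/x)^n ≤ t`, then `n` is at least `(x - 1) * log t⁻¹`. -/
lemma sub_one_mul_log_inv_le_of_pow_le {x t : ℝ} (hx : 1 < x) {n : ℕ}
    (h : (1 - 1 / x) ^ n ≤ t) : (x - 1) * Real.log t⁻¹ ≤ n := by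
  have hx0 : 0 < x := by linarith
  have hx1 : 0 < x - 1 := by linarith
  have hbase : 1 - 1 / x = (x - 1) / x := by field_simp
  have hpos : 0 < 1 - 1 / x := hbase ▸ div_pos hx1 hx0
  have hlog : Real.log t⁻¹ ≤ n * Real.log (1 - 1 / x)⁻¹ := by
    have := Real.log_le_log (pow_pos hpos n) h
    rw [Real.log_pow] at this
    rw [Real.log_inv, Real.log_inv]
    linarith
  have hstep : Real.log (1 - 1 / x)⁻¹ ≤ 1 / (x - 1) := by
    refine (Real.log_le_sub_one_of_pos (inv_pos.mpr hpos)).trans_eq ?_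
    rw [hbase]
    field_simp
    ring
  calc (x - 1) * Real.log t⁻¹ ≤ (x - 1) * (n * (1 / (x - 1))) := by
        gcongr
        exact hlog.trans (by gcongr)
    _ = n := by field_simp

/-- Superpositions of gradient states: if `{a_k}` is orthonormal in `K`,
the unit vectors `ψ_k, φ_k ∈ H` agree except that `⟨ψ_m, φ_m⟩ = 0` for one index `m`, and
`Ψ = (1/√M)Σ a_k ⊗ ψ_k`, `Φ = (1/√M)Σ a_k ⊗ φ_k`, then (i) `⟨Ψ, Φ⟩ = 1 − 1/M`, and
(ii) any `N` with `(1 − 1/M)^{2N} ≤ 0.36` satisfies `N ≥ (M−1)·ln(25/9)/2`,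
i.e. `N = Ω(M)`. -/
theorem statement10 {p q M : ℕ} (hM : 2 ≤ M)
    (a : Fin M → Fin p → ℂ)
    (ha : ∀ k l : Fin M, star (a k) ⬝ᵥ a l = if k = l then 1 else 0)
    (ψ φ : Fin M → Fin q → ℂ)
    (hψ : ∀ k, star (ψ k) ⬝ᵥ ψ k = 1) (hφ : ∀ k, star (φ k) ⬝ᵥ φ k = 1)
    (m : Fin M) (hagree : ∀ k, k ≠ m → ψ k = φ k)
    (horth : star (ψ m) ⬝ᵥ φ m = 0) :
    (star (fun r : Fin p × Fin q =>
        ((Real.sqrt M : ℂ))⁻¹ * ∑ k, a k r.1 * ψ k r.2) ⬝ᵥ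
      (fun r : Fin p × Fin q =>
        ((Real.sqrt M : ℂ))⁻¹ * ∑ k, a k r.1 * φ k r.2)
      = 1 - 1 / (M : ℂ)) ∧
    ∀ N : ℕ, (1 - 1 / (M : ℝ)) ^ (2 * N) ≤ 0.36 →
      ((M : ℝ) - 1) * Real.log (25 / 9) / 2 ≤ (N : ℝ) := by
  have hM1 : (1 : ℝ) < M := by exact_mod_cast hM
  refine ⟨?_, fun N hN => ?_⟩
  · have hMC : (M : ℂ) ≠ 0 := by
      rw [Nat.cast_ne_zero]
      omega
    have hnorm : star ((Real.sqrt M : ℂ))⁻¹ * ((Real.sqrt M : ℂ))⁻¹ = (M : ℂ)⁻¹ := by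
      rw [star_inv₀, Complex.star_def, Complex.conj_ofReal, ← mul_inv, ← Complex.ofReal_mul,
        Real.mul_self_sqrt (Nat.cast_nonneg M), Complex.ofReal_natCast]
    have hoverlap (k : Fin M) : star (ψ k) ⬝ᵥ φ k = 1 - if k = m then 1 else 0 := by
      split_ifs with hk
      · rw [hk, horth, sub_self]
      · rw [hagree k hk, hφ, sub_zero]
    rw [star_dotProduct_sum_tensor a ha, hnorm]
    simp only [hoverlap, Finset.sum_sub_distrib, Finset.sum_ite_eq', Finset.mem_univ, if_true,
      Finset.sum_const, Finset.card_univ, Fintype.card_fin, nsmul_eq_mul, mul_one]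
    field_simp
  · have h := sub_one_mul_log_inv_le_of_pow_le hM1 hN
    have ht : (0.36 : ℝ)⁻¹ = 25 / 9 := by norm_num
    rw [ht] at h
    push_cast at h
    linarith
end

section
/- Fix M ≥ 1, real numbers F₀, g, a constant c > 0, a point θ ∈ ℝ^M, and an index j ∈ {1,…,M}. Let F : ℝ^M → ℝ be the linear function F(x) = F₀ + g·Σ_{i=1}^M x_i, and let Δ be a random vector uniformly distributed on {−1, +1}^M (i.e., with independent Rademacher coordinates). Define the SPSA gradient estimator G_j = (F(θ + cΔ) − F(θ − cΔ))/(2cΔ_j). Then E[G_j] = g and Var[G_j] = g²·(M − 1). -/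
/-- The sign `±1` of a Boolean, giving the uniform Rademacher values. -/
def rademacher (b : Bool) : ℝ := if b then 1 else -1

theorem rademacher_mul_self (b : Bool) : rademacher b * rademacher b = 1 := by
  cases b <;> simp [rademacher]

theorem rademacher_not (b : Bool) : rademacher (!b) = -rademacher b := by
  cases b <;> simp [rademacher]

theorem sum_rademacher_mul_rademacher {ι : Type*} [Fintype ι] [DecidableEq ι] (i k : ι) :
    ∑ s : ι → Bool, rademacher (s i) * rademacher (s k) =
      if i = k then 2 ^ Fintype.card ι else 0 := by
  split_ifs with h
  · subst h
    simp [rademacher_mul_self]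
  · have hflip : Function.Involutive fun s : ι → Bool => Function.update s i (!s i) := by
      intro s
      simp
    have hsum := Equiv.sum_comp hflip.toPerm
      fun s : ι → Bool => rademacher (s i) * rademacher (s k)
    simp only [Function.Involutive.coe_toPerm, Function.update_self,
      Function.update_of_ne (Ne.symm h), rademacher_not, neg_mul, Finset.sum_neg_distrib] at hsum
    linarith

theorem sum_sum_rademacher_mul {ι : Type*} [Fintype ι] [DecidableEq ι] (j : ι) :
    ∑ s : ι → Bool, (∑ i, rademacher (s i)) * rademacher (s j) = 2 ^ Fintype.card ι := by
  simp_rw [Finset.sum_mul]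
  rw [Finset.sum_comm]
  simp [sum_rademacher_mul_rademacher]

theorem sum_sq_sum_rademacher {ι : Type*} [Fintype ι] [DecidableEq ι] :
    ∑ s : ι → Bool, (∑ i, rademacher (s i)) ^ 2 = Fintype.card ι * 2 ^ Fintype.card ι := by
  simp_rw [sq, Finset.mul_sum]
  rw [Finset.sum_comm]
  simp [sum_sum_rademacher_mul]

/-- For the linear function `F(x) = F₀ + g·Σᵢ xᵢ` and `Δ` uniform on
`{−1,+1}^M`, the SPSA estimator `G_j = (F(θ + cΔ) − F(θ − cΔ))/(2cΔ_j)` has mean `g` and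
variance `g²(M − 1)`.  Here the expectation over `Δ` is written as the average over all
`2^M` sign vectors (encoded as `s : Fin M → Bool`, `Δ = rademacher ∘ s`). -/
theorem statement11 {M : ℕ} (hM : 1 ≤ M) (F₀ g c : ℝ) (hc : 0 < c)
    (θ : Fin M → ℝ) (j : Fin M)
    (F : (Fin M → ℝ) → ℝ) (hF : ∀ x, F x = F₀ + g * ∑ i, x i)
    (G : (Fin M → Bool) → ℝ)
    (hG : ∀ s, G s =
      (F (fun i => θ i + c * rademacher (s i)) -
        F (fun i => θ i - c * rademacher (s i))) / (2 * c * rademacher (s j))) :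
    (∑ s : Fin M → Bool, G s) / 2 ^ M = g ∧
    (∑ s : Fin M → Bool, (G s - (∑ t : Fin M → Bool, G t) / 2 ^ M) ^ 2) / 2 ^ M =
      g ^ 2 * ((M : ℝ) - 1) := by
  have hG' : ∀ s, G s = g * ((∑ i, rademacher (s i)) * rademacher (s j)) := by
    intro s
    have hj := rademacher_mul_self (s j)
    have hne : rademacher (s j) ≠ 0 := left_ne_zero_of_mul_eq_one hj
    rw [hG, hF, hF, Finset.sum_add_distrib, Finset.sum_sub_distrib, ← Finset.mul_sum,
      div_eq_iff (by positivity)]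
    linear_combination (-2 * g * c * ∑ i, rademacher (s i)) * hj
  have hsum : ∑ s, G s = g * 2 ^ M := by
    simp_rw [hG', ← Finset.mul_sum, sum_sum_rademacher_mul, Fintype.card_fin]
  have hsq : ∑ s, G s ^ 2 = g ^ 2 * (M * 2 ^ M) := by
    have h : ∀ s, G s ^ 2 = g ^ 2 * (∑ i, rademacher (s i)) ^ 2 := by
      intro s
      rw [hG']
      linear_combination
        (g ^ 2 * (∑ i, rademacher (s i)) ^ 2) * rademacher_mul_self (s j)
    simp_rw [h, ← Finset.mul_sum, sum_sq_sum_rademacher, Fintype.card_fin]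
  have hmean : (∑ s, G s) / 2 ^ M = g := by
    rw [hsum, mul_div_cancel_right₀ _ (by positivity)]
  refine ⟨hmean, ?_⟩
  rw [hmean, div_eq_iff (by positivity)]
  have hexpand : ∑ s, (G s - g) ^ 2 = ∑ s, G s ^ 2 - 2 * g * ∑ s, G s + 2 ^ M * g ^ 2 := by
    simp_rw [sub_sq, Finset.sum_add_distrib, Finset.sum_sub_distrib, Finset.mul_sum]
    simp [mul_right_comm]
  rw [hexpand, hsum, hsq]
  ring
end
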